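/- Let k, k₁, k₂ ∈ ℕ with k₁ ≥ k, k₂ ≥ k and k₁ + k₂ ≥ k + 2, and let δ, δ₁, δ₂ ∈ ℝ with δ₁ + δ₂ ≥ δ - 3/2. Then there exists a constant C > 0 such that for all smooth compactly supported functions u, v : ℝ³ → ℝ, ‖u·v‖_{k,δ} ≤ C · ‖u‖_{k₁,δ₁} · ‖v‖_{k₂,δ₂}. -/

import Mathlib

open MeasureTheory

/-- The partial derivative in the `i`-th coordinate direction. -/
noncomputable def pderiv3 {F : Type*} [NormedAddCommGroup F] [NormedSpace ℝ F]
    (i : Fin 3) (u : EuclideanSpace ℝ (Fin 3) → F) : EuclideanSpace ℝ (Fin 3) → F :=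
  fun x => fderiv ℝ u x (EuclideanSpace.single i 1)

/-- The multi-index partial derivative `∂^α u` with `α = (a,b,c)`. -/
noncomputable def mderiv3 {F : Type*} [NormedAddCommGroup F] [NormedSpace ℝ F]
    (a b c : ℕ) (u : EuclideanSpace ℝ (Fin 3) → F) : EuclideanSpace ℝ (Fin 3) → F :=
  (pderiv3 0)^[a] ((pderiv3 1)^[b] ((pderiv3 2)^[c] u))

/-- The weighted Sobolev norm of integer order,
`‖u‖²_{k,δ} = Σ_{|α|≤k} ∫ ((1+|x|)^{δ+|α|} |∂^α u|)² dx`. -/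
noncomputable def wnorm (k : ℕ) (δ : ℝ) {F : Type*} [NormedAddCommGroup F]
    [NormedSpace ℝ F] (u : EuclideanSpace ℝ (Fin 3) → F) : ℝ :=
  Real.sqrt (∑ a ∈ Finset.Iic k, ∑ b ∈ Finset.Iic k, ∑ c ∈ Finset.Iic k,
    if a + b + c ≤ k then
      ∫ x : EuclideanSpace ℝ (Fin 3),
        ((1 + ‖x‖) ^ (δ + (a : ℝ) + b + c) * ‖mderiv3 a b c u x‖) ^ 2
    else 0)

/-- Smooth compactly supported real functions on `ℝ³`. -/
def IsTest (f : EuclideanSpace ℝ (Fin 3) → ℝ) : Prop :=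
  ContDiff ℝ (⊤ : ℕ∞) f ∧ HasCompactSupport f

/-- The squared weighted `L²` norm. -/
noncomputable def wL2 (δ : ℝ) (f : EuclideanSpace ℝ (Fin 3) → ℝ) : ℝ :=
  ∫ x : EuclideanSpace ℝ (Fin 3), ((1 + ‖x‖) ^ δ * ‖f x‖) ^ 2

/-- The square of the weighted Sobolev norm `wnorm`. -/
noncomputable def wsq (k : ℕ) (δ : ℝ) (f : EuclideanSpace ℝ (Fin 3) → ℝ) : ℝ :=
  ∑ a ∈ Finset.Iic k, ∑ b ∈ Finset.Iic k, ∑ c ∈ Finset.Iic k,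
    if a + b + c ≤ k then wL2 (δ + (a : ℝ) + b + c) (mderiv3 a b c f) else 0

lemma wL2_nonneg (δ : ℝ) (f : EuclideanSpace ℝ (Fin 3) → ℝ) : 0 ≤ wL2 δ f :=
  integral_nonneg fun _ => sq_nonneg _

lemma wsq_nonneg (k : ℕ) (δ : ℝ) (f : EuclideanSpace ℝ (Fin 3) → ℝ) : 0 ≤ wsq k δ f := by
  unfold wsq
  refine Finset.sum_nonneg fun a _ => Finset.sum_nonneg fun b _ => Finset.sum_nonneg fun c _ => ?_
  split_ifs
  · exact wL2_nonneg _ _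
  · exact le_rfl

lemma wnorm_eq_sqrt_wsq (k : ℕ) (δ : ℝ) (f : EuclideanSpace ℝ (Fin 3) → ℝ) :
    wnorm k δ f = Real.sqrt (wsq k δ f) := rfl

lemma wL2_mderiv3_le_wsq {k : ℕ} (δ : ℝ) (f : EuclideanSpace ℝ (Fin 3) → ℝ) {a b c : ℕ}
    (h : a + b + c ≤ k) : wL2 (δ + (a : ℝ) + b + c) (mderiv3 a b c f) ≤ wsq k δ f := by
  have hn : ∀ a b c : ℕ, 0 ≤ if a + b + c ≤ k then
      wL2 (δ + (a : ℝ) + b + c) (mderiv3 a b c f) else 0 := by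
    intro a b c
    split_ifs
    · exact wL2_nonneg _ _
    · exact le_rfl
  unfold wsq
  calc _ = (if a + b + c ≤ k then wL2 (δ + (a : ℝ) + b + c) (mderiv3 a b c f) else 0) := by
        rw [if_pos h]
    _ ≤ ∑ c ∈ Finset.Iic k, _ := Finset.single_le_sum (s := Finset.Iic k)
        (f := fun c : ℕ => if a + b + c ≤ k then
          wL2 (δ + (a : ℝ) + b + c) (mderiv3 a b c f) else 0)
        (fun c _ => hn a b c) (Finset.mem_Iic.2 (by omega))
    _ ≤ ∑ b ∈ Finset.Iic k, _ := Finset.single_le_sum (s := Finset.Iic k)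
        (f := fun b : ℕ => ∑ c ∈ Finset.Iic k, if a + b + c ≤ k then
          wL2 (δ + (a : ℝ) + b + c) (mderiv3 a b c f) else 0)
        (fun b _ => Finset.sum_nonneg fun c _ => hn a b c) (Finset.mem_Iic.2 (by omega))
    _ ≤ _ := Finset.single_le_sum (s := Finset.Iic k)
        (f := fun a : ℕ => ∑ b ∈ Finset.Iic k, ∑ c ∈ Finset.Iic k, if a + b + c ≤ k then
          wL2 (δ + (a : ℝ) + b + c) (mderiv3 a b c f) else 0)
        (fun a _ => Finset.sum_nonneg fun b _ => Finset.sum_nonneg fun c _ => hn a b c)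
        (Finset.mem_Iic.2 (by omega))

lemma wsq_le_of_forall {k : ℕ} {δ : ℝ} {f : EuclideanSpace ℝ (Fin 3) → ℝ} {M : ℝ} (hM : 0 ≤ M)
    (h : ∀ a b c : ℕ, a + b + c ≤ k →
      wL2 (δ + (a : ℝ) + b + c) (mderiv3 a b c f) ≤ M) :
    wsq k δ f ≤ ((k : ℝ) + 1) ^ 3 * M := by
  unfold wsq
  calc _ ≤ ∑ a ∈ Finset.Iic k, ∑ b ∈ Finset.Iic k, ∑ c ∈ Finset.Iic k, M := by
        refine Finset.sum_le_sum fun a _ => Finset.sum_le_sum fun b _ =>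
          Finset.sum_le_sum fun c _ => ?_
        split_ifs with hh
        · exact h a b c hh
        · exact hM
    _ = _ := by
        simp only [Finset.sum_const, Nat.card_Iic, nsmul_eq_mul]
        push_cast
        ring

lemma IsTest.continuous {f : EuclideanSpace ℝ (Fin 3) → ℝ} (hf : IsTest f) : Continuous f :=
  hf.1.continuous

lemma IsTest.pderiv3 {f : EuclideanSpace ℝ (Fin 3) → ℝ} (hf : IsTest f) (i : Fin 3) :
    IsTest (pderiv3 i f) := by
  refine ⟨?_, ?_⟩
  · exact (hf.1.fderiv_right (m := (⊤ : ℕ∞)) (by simp)).clm_apply contDiff_const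
  · exact hf.2.fderiv_apply ℝ _

lemma IsTest.iterate_pderiv3 {f : EuclideanSpace ℝ (Fin 3) → ℝ} (hf : IsTest f) (i : Fin 3)
    (n : ℕ) : IsTest ((_root_.pderiv3 i)^[n] f) := by
  induction n with
  | zero => exact hf
  | succ n ih => rw [Function.iterate_succ_apply']; exact ih.pderiv3 i

lemma IsTest.mderiv3 {f : EuclideanSpace ℝ (Fin 3) → ℝ} (hf : IsTest f) (a b c : ℕ) :
    IsTest (mderiv3 a b c f) :=
  ((hf.iterate_pderiv3 2 c).iterate_pderiv3 1 b).iterate_pderiv3 0 a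

lemma IsTest.mul {f g : EuclideanSpace ℝ (Fin 3) → ℝ} (hf : IsTest f) (hg : IsTest g) :
    IsTest (fun x => f x * g x) :=
  ⟨hf.1.mul hg.1, hf.2.mul_right⟩

lemma IsTest.add {f g : EuclideanSpace ℝ (Fin 3) → ℝ} (hf : IsTest f) (hg : IsTest g) :
    IsTest (fun x => f x + g x) :=
  ⟨hf.1.add hg.1, hf.2.add hg.2⟩

lemma IsTest.differentiable {f : EuclideanSpace ℝ (Fin 3) → ℝ} (hf : IsTest f) :
    Differentiable ℝ f :=
  hf.1.differentiable (by simp)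

lemma pderiv3_comm {f : EuclideanSpace ℝ (Fin 3) → ℝ} (hf : IsTest f) (i j : Fin 3) :
    pderiv3 i (pderiv3 j f) = pderiv3 j (pderiv3 i f) := by
  have hd : Differentiable ℝ (fderiv ℝ f) :=
    (hf.1.fderiv_right (m := (⊤ : ℕ∞)) (by simp)).differentiable (by simp)
  have key : ∀ (i j : Fin 3) x, pderiv3 i (pderiv3 j f) x =
      fderiv ℝ (fderiv ℝ f) x (EuclideanSpace.single i 1) (EuclideanSpace.single j 1) := by
    intro i j x
    unfold pderiv3
    rw [fderiv_clm_apply (hd x) (differentiableAt_const _)]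
    simp
  ext x
  rw [key, key]
  exact ((hf.1.contDiffAt (x := x)).isSymmSndFDerivAt (by
    simpa using WithTop.coe_le_coe.2 (le_top : (2 : ℕ∞) ≤ ⊤))).eq _ _

lemma pderiv3_iterate_comm {f : EuclideanSpace ℝ (Fin 3) → ℝ} (hf : IsTest f) (i j : Fin 3)
    (n : ℕ) : pderiv3 i ((pderiv3 j)^[n] f) = (pderiv3 j)^[n] (pderiv3 i f) := by
  induction n with
  | zero => rfl
  | succ n ih =>
    rw [Function.iterate_succ_apply', Function.iterate_succ_apply', ← ih,
      pderiv3_comm (hf.iterate_pderiv3 j n)]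

lemma mderiv3_pderiv3_zero {f : EuclideanSpace ℝ (Fin 3) → ℝ} (hf : IsTest f) (a b c : ℕ) :
    mderiv3 a b c (pderiv3 0 f) = mderiv3 (a + 1) b c f := by
  unfold mderiv3
  rw [← pderiv3_iterate_comm hf, ← pderiv3_iterate_comm (hf.iterate_pderiv3 2 c),
    Function.iterate_succ_apply]

lemma mderiv3_pderiv3_one {f : EuclideanSpace ℝ (Fin 3) → ℝ} (hf : IsTest f) (a b c : ℕ) :
    mderiv3 a b c (pderiv3 1 f) = mderiv3 a (b + 1) c f := by
  unfold mderiv3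
  rw [← pderiv3_iterate_comm hf, Function.iterate_succ_apply]

lemma mderiv3_pderiv3_two (f : EuclideanSpace ℝ (Fin 3) → ℝ) (a b c : ℕ) :
    mderiv3 a b c (pderiv3 2 f) = mderiv3 a b (c + 1) f := rfl

lemma wsq_pderiv3_le {f : EuclideanSpace ℝ (Fin 3) → ℝ} (hf : IsTest f) (k : ℕ) (δ : ℝ)
    (i : Fin 3) : wsq k (δ + 1) (pderiv3 i f) ≤ ((k : ℝ) + 1) ^ 3 * wsq (k + 1) δ f := by
  refine wsq_le_of_forall (wsq_nonneg _ _ _) fun a b c h => ?_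
  fin_cases i
  · have := wL2_mderiv3_le_wsq (k := k + 1) δ f (a := a + 1) (b := b) (c := c) (by omega)
    rw [← mderiv3_pderiv3_zero hf] at this
    refine le_trans (le_of_eq ?_) this
    congr 1
    push_cast; ring
  · have := wL2_mderiv3_le_wsq (k := k + 1) δ f (a := a) (b := b + 1) (c := c) (by omega)
    rw [← mderiv3_pderiv3_one hf] at this
    refine le_trans (le_of_eq ?_) this
    congr 1
    push_cast; ring
  · have := wL2_mderiv3_le_wsq (k := k + 1) δ f (a := a) (b := b) (c := c + 1) (by omega)
    rw [← mderiv3_pderiv3_two] at this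
    refine le_trans (le_of_eq ?_) this
    congr 1
    push_cast; ring

lemma wsq_succ_le {f : EuclideanSpace ℝ (Fin 3) → ℝ} (hf : IsTest f) (k : ℕ) (δ : ℝ) :
    wsq (k + 1) δ f ≤ ((k : ℝ) + 2) ^ 3 *
      (wL2 δ f + ∑ i, wsq k (δ + 1) (pderiv3 i f)) := by
  have hs : ∀ i, wsq k (δ + 1) (pderiv3 i f) ≤ ∑ i, wsq k (δ + 1) (pderiv3 i f) := fun i =>
    Finset.single_le_sum (f := fun i => wsq k (δ + 1) (pderiv3 i f))
      (fun i _ => wsq_nonneg _ _ _) (Finset.mem_univ i)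
  have h0 := wL2_nonneg δ f
  have h1 : 0 ≤ ∑ i, wsq k (δ + 1) (pderiv3 i f) :=
    Finset.sum_nonneg fun _ _ => wsq_nonneg _ _ _
  have hk : ((k : ℝ) + 2) = ((k + 1 : ℕ) : ℝ) + 1 := by push_cast; ring
  rw [hk]
  refine wsq_le_of_forall (add_nonneg h0 h1) fun a b c h => ?_
  rcases a with _ | a
  · rcases b with _ | b
    · rcases c with _ | c
      · have : wL2 (δ + ((0 : ℕ) : ℝ) + (0 : ℕ) + (0 : ℕ)) (mderiv3 0 0 0 f) = wL2 δ f := by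
          simp [mderiv3]
        rw [this]; linarith
      · have := wL2_mderiv3_le_wsq (k := k) (δ + 1) (pderiv3 2 f) (a := 0) (b := 0) (c := c)
          (by omega)
        rw [mderiv3_pderiv3_two] at this
        refine le_trans (le_of_eq ?_) (this.trans ((hs 2).trans (by linarith)))
        congr 1; push_cast; ring
    · have := wL2_mderiv3_le_wsq (k := k) (δ + 1) (pderiv3 1 f) (a := 0) (b := b) (c := c)
        (by omega)
      rw [mderiv3_pderiv3_one hf] at this
      refine le_trans (le_of_eq ?_) (this.trans ((hs 1).trans (by linarith)))
      congr 1; push_cast; ring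
  · have := wL2_mderiv3_le_wsq (k := k) (δ + 1) (pderiv3 0 f) (a := a) (b := b) (c := c)
      (by omega)
    rw [mderiv3_pderiv3_zero hf] at this
    refine le_trans (le_of_eq ?_) (this.trans ((hs 0).trans (by linarith)))
    congr 1; push_cast; ring

lemma wsq_zero (δ : ℝ) (f : EuclideanSpace ℝ (Fin 3) → ℝ) : wsq 0 δ f = wL2 δ f := by
  simp [wsq, mderiv3, show Finset.Iic 0 = {0} from rfl]

lemma wsq_mono {k l : ℕ} (h : k ≤ l) (δ : ℝ) (f : EuclideanSpace ℝ (Fin 3) → ℝ) :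
    wsq k δ f ≤ ((k : ℝ) + 1) ^ 3 * wsq l δ f :=
  wsq_le_of_forall (wsq_nonneg _ _ _) fun _ _ _ h' => wL2_mderiv3_le_wsq δ f (h'.trans h)

lemma continuous_weight (δ : ℝ) :
    Continuous fun x : EuclideanSpace ℝ (Fin 3) => (1 + ‖x‖) ^ δ := by
  refine Continuous.rpow_const (by fun_prop) fun x => Or.inl ?_
  positivity

lemma integrable_weight_pow {f : EuclideanSpace ℝ (Fin 3) → ℝ} (hf : Continuous f)
    (hc : HasCompactSupport f) (δ : ℝ) {n : ℕ} (hn : n ≠ 0) :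
    Integrable fun x : EuclideanSpace ℝ (Fin 3) => ((1 + ‖x‖) ^ δ * ‖f x‖) ^ n := by
  refine Continuous.integrable_of_hasCompactSupport
    (((continuous_weight δ).mul hf.norm).pow n) ?_
  refine hc.mono fun x hx => ?_
  contrapose! hx
  simp only [Function.mem_support, not_not] at hx ⊢
  simp [hx, hn]

lemma wL2_add_le {f g : EuclideanSpace ℝ (Fin 3) → ℝ} (hf : IsTest f) (hg : IsTest g) (δ : ℝ) :
    wL2 δ (fun x => f x + g x) ≤ 2 * (wL2 δ f + wL2 δ g) := by
  unfold wL2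
  rw [← integral_add (integrable_weight_pow hf.continuous hf.2 δ two_ne_zero)
    (integrable_weight_pow hg.continuous hg.2 δ two_ne_zero), ← integral_const_mul]
  refine integral_mono (integrable_weight_pow (hf.add hg).continuous (hf.add hg).2 δ two_ne_zero)
    (((integrable_weight_pow hf.continuous hf.2 δ two_ne_zero).add
      (integrable_weight_pow hg.continuous hg.2 δ two_ne_zero)).const_mul 2) fun x => ?_
  simp only [mul_pow, Real.norm_eq_abs, sq_abs]
  have : 0 ≤ ((1 + ‖x‖) ^ δ) ^ 2 := sq_nonneg _
  nlinarith [mul_nonneg this (sq_nonneg (f x - g x))]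

lemma pderiv3_add {f g : EuclideanSpace ℝ (Fin 3) → ℝ} (hf : IsTest f) (hg : IsTest g)
    (i : Fin 3) : pderiv3 i (fun x => f x + g x) = fun x => pderiv3 i f x + pderiv3 i g x := by
  ext x
  unfold pderiv3
  rw [fderiv_fun_add (hf.differentiable x) (hg.differentiable x)]
  rfl

lemma iterate_pderiv3_add {f g : EuclideanSpace ℝ (Fin 3) → ℝ} (hf : IsTest f) (hg : IsTest g)
    (i : Fin 3) (n : ℕ) : (pderiv3 i)^[n] (fun x => f x + g x) =
      fun x => (pderiv3 i)^[n] f x + (pderiv3 i)^[n] g x := by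
  induction n with
  | zero => rfl
  | succ n ih =>
    simp only [Function.iterate_succ_apply']
    rw [ih, pderiv3_add (hf.iterate_pderiv3 i n) (hg.iterate_pderiv3 i n)]

lemma wsq_add_le {f g : EuclideanSpace ℝ (Fin 3) → ℝ} (hf : IsTest f) (hg : IsTest g)
    (k : ℕ) (δ : ℝ) : wsq k δ (fun x => f x + g x) ≤
      ((k : ℝ) + 1) ^ 3 * (2 * (wsq k δ f + wsq k δ g)) := by
  have hf0 := wsq_nonneg k δ f
  have hg0 := wsq_nonneg k δ g
  refine wsq_le_of_forall (by positivity) fun a b c h => ?_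
  have e : mderiv3 a b c (fun x => f x + g x) = fun x => mderiv3 a b c f x + mderiv3 a b c g x := by
    unfold mderiv3
    rw [iterate_pderiv3_add hf hg,
      iterate_pderiv3_add (hf.iterate_pderiv3 2 c) (hg.iterate_pderiv3 2 c),
      iterate_pderiv3_add ((hf.iterate_pderiv3 2 c).iterate_pderiv3 1 b)
        ((hg.iterate_pderiv3 2 c).iterate_pderiv3 1 b)]
  rw [e]
  refine (wL2_add_le (hf.mderiv3 a b c) (hg.mderiv3 a b c) _).trans ?_
  have := wL2_mderiv3_le_wsq δ f h
  have := wL2_mderiv3_le_wsq δ g h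
  linarith

lemma pderiv3_mul {f g : EuclideanSpace ℝ (Fin 3) → ℝ} (hf : IsTest f) (hg : IsTest g)
    (i : Fin 3) : pderiv3 i (fun x => f x * g x) =
      fun x => pderiv3 i f x * g x + f x * pderiv3 i g x := by
  ext x
  unfold pderiv3
  rw [fderiv_fun_mul (hf.differentiable x) (hg.differentiable x)]
  simp
  ring

lemma rpow_le_rpow_of_comparable {s t c : ℝ} (hs : 0 < s) (ht : 0 < t) (hc : 0 < c)
    (hst : s ≤ c * t) (hts : t ≤ c * s) (a : ℝ) : s ^ a ≤ c ^ |a| * t ^ a := by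
  rcases le_or_gt 0 a with ha | ha
  · rw [abs_of_nonneg ha, ← Real.mul_rpow hc.le ht.le]
    exact Real.rpow_le_rpow hs.le hst ha
  · rw [abs_of_neg ha, Real.rpow_neg hc.le, ← Real.inv_rpow hc.le,
      ← Real.mul_rpow (inv_nonneg.2 hc.le) ht.le]
    refine Real.rpow_le_rpow_of_nonpos (by positivity) ?_ ha.le
    rw [inv_mul_le_iff₀ hc]
    exact hts

lemma weight_le_smooth_weight (a : ℝ) (x : EuclideanSpace ℝ (Fin 3)) :
    (1 + ‖x‖) ^ a ≤ 2 ^ |a / 2| * (1 + ‖x‖ ^ 2) ^ (a / 2) := by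
  have e : (1 + ‖x‖) ^ a = ((1 + ‖x‖) ^ 2) ^ (a / 2) := by
    rw [← Real.rpow_natCast, ← Real.rpow_mul (by positivity)]
    congr 1; push_cast; ring
  have := norm_nonneg x
  rw [e]
  exact rpow_le_rpow_of_comparable (by positivity) (by positivity) two_pos
    (by nlinarith [sq_nonneg (1 - ‖x‖)]) (by nlinarith) _

lemma smooth_weight_le_weight (a : ℝ) (x : EuclideanSpace ℝ (Fin 3)) :
    (1 + ‖x‖ ^ 2) ^ (a / 2) ≤ 2 ^ |a / 2| * (1 + ‖x‖) ^ a := by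
  have e : (1 + ‖x‖) ^ a = ((1 + ‖x‖) ^ 2) ^ (a / 2) := by
    rw [← Real.rpow_natCast, ← Real.rpow_mul (by positivity)]
    congr 1; push_cast; ring
  have := norm_nonneg x
  rw [e]
  exact rpow_le_rpow_of_comparable (by positivity) (by positivity) two_pos
    (by nlinarith) (by nlinarith [sq_nonneg (1 - ‖x‖)]) _

lemma norm_le_sum_norm_apply_single (L : EuclideanSpace ℝ (Fin 3) →L[ℝ] ℝ) :
    ‖L‖ ≤ ∑ i, ‖L (EuclideanSpace.single i 1)‖ := by
  refine L.opNorm_le_bound (by positivity) fun v => ?_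
  have hv : v = ∑ i, v i • EuclideanSpace.single i (1 : ℝ) := by
    ext j
    simp [Finset.sum_apply, Pi.single_apply]
  calc ‖L v‖ = ‖∑ i, v i • L (EuclideanSpace.single i 1)‖ := by
        conv_lhs => rw [hv]
        simp
    _ ≤ ∑ i, ‖v i • L (EuclideanSpace.single i 1)‖ := norm_sum_le _ _
    _ ≤ ∑ i, ‖L (EuclideanSpace.single i 1)‖ * ‖v‖ := by
        refine Finset.sum_le_sum fun i _ => ?_
        rw [norm_smul, mul_comm]
        exact mul_le_mul_of_nonneg_left (PiLp.norm_apply_le v i) (norm_nonneg _)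
    _ = _ := by rw [Finset.sum_mul]

lemma contDiff_smooth_weight (a : ℝ) :
    ContDiff ℝ 1 fun x : EuclideanSpace ℝ (Fin 3) => (1 + ‖x‖ ^ 2) ^ a := by
  refine ContDiff.rpow_const_of_ne (contDiff_const.add (contDiff_norm_sq ℝ)) fun x => ?_
  positivity

lemma norm_fderiv_smooth_weight_le (a : ℝ) (x : EuclideanSpace ℝ (Fin 3)) :
    ‖fderiv ℝ (fun x : EuclideanSpace ℝ (Fin 3) => (1 + ‖x‖ ^ 2) ^ a) x‖ ≤
      2 * |a| * (1 + ‖x‖ ^ 2) ^ (a - 1 / 2) := by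
  have hq : HasFDerivAt (fun x : EuclideanSpace ℝ (Fin 3) => 1 + ‖x‖ ^ 2)
      (2 • (innerSL ℝ x)) x := by
    exact ((hasStrictFDerivAt_norm_sq x).hasFDerivAt).const_add 1
  have hp : (0 : ℝ) < 1 + ‖x‖ ^ 2 := by positivity
  have h := hq.rpow_const (p := a) (Or.inl hp.ne')
  have hx : ‖x‖ ≤ (1 + ‖x‖ ^ 2) ^ (1 / 2 : ℝ) := by
    rw [← Real.sqrt_eq_rpow]
    exact Real.le_sqrt_of_sq_le (by linarith)
  rw [h.fderiv, norm_smul, two_smul, ← two_smul ℝ, norm_smul, innerSL_apply_norm, norm_mul,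
    Real.norm_eq_abs, Real.norm_eq_abs, abs_of_pos (Real.rpow_pos_of_pos hp _)]
  have e : (1 + ‖x‖ ^ 2) ^ (a - 1 / 2) = (1 + ‖x‖ ^ 2) ^ (a - 1) * (1 + ‖x‖ ^ 2) ^ (1 / 2 : ℝ) := by
    rw [← Real.rpow_add hp]; congr 1; ring
  rw [e]
  have h2 : ‖(2 : ℝ)‖ = 2 := by norm_num
  rw [h2]
  calc |a| * (1 + ‖x‖ ^ 2) ^ (a - 1) * (2 * ‖x‖) = 2 * |a| * ((1 + ‖x‖ ^ 2) ^ (a - 1) * ‖x‖) := by ring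
    _ ≤ _ := by gcongr

lemma integral_norm_pow_six_le (g : EuclideanSpace ℝ (Fin 3) → ℝ) (hg : ContDiff ℝ 1 g)
    (hc : HasCompactSupport g) :
    ∫ x, ‖g x‖ ^ 6 ≤
      (SNormLESNormFDerivOfEqConst ℝ (volume : Measure (EuclideanSpace ℝ (Fin 3))) 2 : ℝ) ^ 6 *
        (∫ x, ‖fderiv ℝ g x‖ ^ 2) ^ 3 := by
  have key := eLpNorm_le_eLpNorm_fderiv_of_eq (F := ℝ)
    (volume : Measure (EuclideanSpace ℝ (Fin 3))) hg hc (p := 2) (p' := 6) (by norm_num)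
    (by simp) (by simp; norm_num)
  have i6 : Integrable (fun x => ‖g x‖ ^ 6) := by
    refine (hg.continuous.norm.pow 6).integrable_of_hasCompactSupport (hc.mono fun x hx => ?_)
    contrapose! hx
    simp only [Function.mem_support, not_not] at hx ⊢
    simp [hx]
  have hD : Continuous (fderiv ℝ g) := hg.continuous_fderiv one_ne_zero
  have i2 : Integrable (fun x => ‖fderiv ℝ g x‖ ^ 2) := by
    refine (hD.norm.pow 2).integrable_of_hasCompactSupport ((hc.fderiv ℝ).mono fun x hx => ?_)
    contrapose! hx
    simp only [Function.mem_support, not_not] at hx ⊢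
    simp [hx]
  have e6 : eLpNorm g (6 : NNReal) volume ^ 6 = ENNReal.ofReal (∫ x, ‖g x‖ ^ 6) := by
    have := eLpNorm_nnreal_pow_eq_lintegral (f := g) (p := 6)
      (μ := (volume : Measure (EuclideanSpace ℝ (Fin 3)))) (by norm_num)
    rw [ofReal_integral_eq_lintegral_ofReal i6 (Filter.Eventually.of_forall fun x => by positivity)]
    norm_num at this ⊢
    rw [this]
    refine lintegral_congr fun x => ?_
    rw [Real.enorm_eq_ofReal_abs]
  have e2 : eLpNorm (fderiv ℝ g) (2 : NNReal) volume ^ 2 =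
      ENNReal.ofReal (∫ x, ‖fderiv ℝ g x‖ ^ 2) := by
    have := eLpNorm_nnreal_pow_eq_lintegral (f := fderiv ℝ g) (p := 2)
      (μ := (volume : Measure (EuclideanSpace ℝ (Fin 3)))) (by norm_num)
    rw [ofReal_integral_eq_lintegral_ofReal i2 (Filter.Eventually.of_forall fun x => by positivity)]
    norm_num at this ⊢
    rw [this]
  have h := pow_le_pow_left' key 6
  rw [mul_pow, e6, show (6 : ℕ) = 2 * 3 from rfl, pow_mul (eLpNorm (fderiv ℝ g) _ _), e2,
    ← ENNReal.ofReal_pow (by positivity), ← ENNReal.ofReal_coe_nnreal,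
    ← ENNReal.ofReal_pow (by positivity), ← ENNReal.ofReal_mul (by positivity)] at h
  exact (ENNReal.ofReal_le_ofReal_iff (by positivity)).1 h

lemma wL2_le_wsq_one (δ : ℝ) (f : EuclideanSpace ℝ (Fin 3) → ℝ) : wL2 δ f ≤ wsq 1 δ f := by
  have := wsq_mono (zero_le_one (α := ℕ)) δ f
  simpa [wsq_zero] using this

lemma wL2_pderiv3_le_wsq_one {f : EuclideanSpace ℝ (Fin 3) → ℝ} (hf : IsTest f) (δ : ℝ)
    (i : Fin 3) : wL2 (δ + 1) (pderiv3 i f) ≤ wsq 1 δ f := by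
  have := wsq_pderiv3_le hf 0 δ i
  simpa [wsq_zero] using this

/-- Weighted Sobolev inequality: the weighted `L⁶` norm is controlled by the weighted `H¹` norm. -/
lemma exists_integral_weight_pow_six_le (δ : ℝ) : ∃ C : ℝ, 0 < C ∧
    ∀ f : EuclideanSpace ℝ (Fin 3) → ℝ, IsTest f →
      ∫ x, ((1 + ‖x‖) ^ (δ + 1) * ‖f x‖) ^ 6 ≤ C * wsq 1 δ f ^ 3 := by
  set S : ℝ := (SNormLESNormFDerivOfEqConst ℝ
    (volume : Measure (EuclideanSpace ℝ (Fin 3))) 2 : ℝ) with hS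
  have hS0 : 0 ≤ S := NNReal.coe_nonneg _
  set a : ℝ := (δ + 1) / 2 with ha
  set K : ℝ := 2 ^ |a| with hK
  have hK0 : 0 < K := by positivity
  set L : ℝ := 2 * |a| * 2 ^ |δ / 2| with hL
  have hL0 : 0 ≤ L := by positivity
  refine ⟨K ^ 6 * ((S + 1) ^ 6 * (4 * (L + K) ^ 2 * 4) ^ 3), by positivity, fun f hf => ?_⟩
  set g : EuclideanSpace ℝ (Fin 3) → ℝ := fun x => (1 + ‖x‖ ^ 2) ^ a * f x with hg
  have hw := contDiff_smooth_weight a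
  have hgd : ContDiff ℝ 1 g := hw.mul (hf.1.of_le (by simp))
  have hgc : HasCompactSupport g := hf.2.mul_left
  have hfd : Differentiable ℝ f := hf.differentiable
  -- the derivative of `g` is pointwise bounded by the integrands of the weighted norm
  have hpt : ∀ x, ‖fderiv ℝ g x‖ ≤ (L + K) * ((1 + ‖x‖) ^ δ * ‖f x‖ +
      ∑ i, (1 + ‖x‖) ^ (δ + 1) * ‖pderiv3 i f x‖) := by
    intro x
    have e : fderiv ℝ g x = ((1 + ‖x‖ ^ 2) ^ a) • fderiv ℝ f x +
        f x • fderiv ℝ (fun x : EuclideanSpace ℝ (Fin 3) => (1 + ‖x‖ ^ 2) ^ a) x :=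
      fderiv_fun_mul (hw.differentiable one_ne_zero x) (hfd x)
    have h1 : ‖(1 + ‖x‖ ^ 2) ^ a‖ ≤ K * (1 + ‖x‖) ^ (δ + 1) := by
      rw [Real.norm_of_nonneg (by positivity)]
      exact smooth_weight_le_weight (δ + 1) x
    have h2 : ‖fderiv ℝ (fun x : EuclideanSpace ℝ (Fin 3) => (1 + ‖x‖ ^ 2) ^ a) x‖ ≤
        L * (1 + ‖x‖) ^ δ := by
      refine (norm_fderiv_smooth_weight_le a x).trans ?_
      rw [show a - 1 / 2 = δ / 2 by rw [ha]; ring, hL, mul_assoc (2 * |a|)]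
      exact mul_le_mul_of_nonneg_left (smooth_weight_le_weight δ x) (by positivity)
    have h3 : ‖fderiv ℝ f x‖ ≤ ∑ i, ‖pderiv3 i f x‖ := norm_le_sum_norm_apply_single _
    rw [e, ← Finset.mul_sum]
    refine (norm_add_le _ _).trans ?_
    rw [norm_smul, norm_smul]
    have h4 : ‖(1 + ‖x‖ ^ 2) ^ a‖ * ‖fderiv ℝ f x‖ ≤
        K * (1 + ‖x‖) ^ (δ + 1) * ∑ i, ‖pderiv3 i f x‖ :=
      mul_le_mul h1 h3 (norm_nonneg _) (by positivity)
    have h5 := mul_le_mul_of_nonneg_left h2 (norm_nonneg (f x))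
    have p1 : 0 ≤ (1 + ‖x‖) ^ (δ + 1) * ∑ i, ‖pderiv3 i f x‖ := by positivity
    have p2 : 0 ≤ (1 + ‖x‖) ^ δ * ‖f x‖ := by positivity
    nlinarith [mul_nonneg hL0 p1, mul_nonneg hK0.le p2]
  have hI0 := integrable_weight_pow hf.continuous hf.2 δ two_ne_zero
  have hI := fun i => integrable_weight_pow (hf.pderiv3 i).continuous (hf.pderiv3 i).2 (δ + 1)
    two_ne_zero
  have hD : ∫ x, ‖fderiv ℝ g x‖ ^ 2 ≤ 4 * (L + K) ^ 2 * 4 * wsq 1 δ f := by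
    calc ∫ x, ‖fderiv ℝ g x‖ ^ 2 ≤ ∫ x, 4 * (L + K) ^ 2 * (((1 + ‖x‖) ^ δ * ‖f x‖) ^ 2 +
          ∑ i, ((1 + ‖x‖) ^ (δ + 1) * ‖pderiv3 i f x‖) ^ 2) := by
          refine integral_mono_of_nonneg (Filter.Eventually.of_forall fun x => by positivity)
            ((hI0.add (integrable_finsetSum _ fun i _ => hI i)).const_mul _)
            (Filter.Eventually.of_forall fun x => ?_)
          refine (pow_le_pow_left₀ (norm_nonneg _) (hpt x) 2).trans ?_
          simp only [Fin.sum_univ_three, mul_pow (L + K)]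
          generalize (1 + ‖x‖) ^ δ * ‖f x‖ = A
          generalize (1 + ‖x‖) ^ (δ + 1) * ‖pderiv3 0 f x‖ = B
          generalize (1 + ‖x‖) ^ (δ + 1) * ‖pderiv3 1 f x‖ = D
          generalize (1 + ‖x‖) ^ (δ + 1) * ‖pderiv3 2 f x‖ = E
          have : (A + (B + D + E)) ^ 2 ≤ 4 * (A ^ 2 + (B ^ 2 + D ^ 2 + E ^ 2)) := by
            nlinarith [sq_nonneg (A - B), sq_nonneg (A - D), sq_nonneg (A - E),
              sq_nonneg (B - D), sq_nonneg (B - E), sq_nonneg (D - E)]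
          have h := mul_le_mul_of_nonneg_left this (sq_nonneg (L + K))
          linarith
      _ = 4 * (L + K) ^ 2 * (wL2 δ f + ∑ i, wL2 (δ + 1) (pderiv3 i f)) := by
          rw [integral_const_mul, integral_add hI0 (integrable_finsetSum _ fun i _ => hI i),
            integral_finsetSum _ fun i _ => hI i]
          rfl
      _ ≤ _ := by
          rw [mul_assoc (4 * (L + K) ^ 2)]
          refine mul_le_mul_of_nonneg_left ?_ (by positivity)
          rw [Fin.sum_univ_three]
          have := wL2_le_wsq_one δ f
          have := wL2_pderiv3_le_wsq_one hf δ 0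
          have := wL2_pderiv3_le_wsq_one hf δ 1
          have := wL2_pderiv3_le_wsq_one hf δ 2
          linarith
  have hw0 := wsq_nonneg 1 δ f
  have i6 : Integrable (fun x => ‖g x‖ ^ 6) := by
    refine (hgd.continuous.norm.pow 6).integrable_of_hasCompactSupport (hgc.mono fun x hx => ?_)
    contrapose! hx
    simp only [Function.mem_support, not_not] at hx ⊢
    simp [hx]
  calc ∫ x, ((1 + ‖x‖) ^ (δ + 1) * ‖f x‖) ^ 6 ≤ ∫ x, K ^ 6 * ‖g x‖ ^ 6 := by
        refine integral_mono (integrable_weight_pow hf.continuous hf.2 _ (by norm_num))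
          (i6.const_mul _) fun x => ?_
        simp only
        rw [← mul_pow]
        refine pow_le_pow_left₀ (by positivity) ?_ 6
        rw [hg, norm_mul, ← mul_assoc,
          Real.norm_of_nonneg (show 0 ≤ (1 + ‖x‖ ^ 2) ^ a by positivity)]
        exact mul_le_mul_of_nonneg_right (weight_le_smooth_weight (δ + 1) x) (norm_nonneg _)
    _ = K ^ 6 * ∫ x, ‖g x‖ ^ 6 := integral_const_mul _ _
    _ ≤ K ^ 6 * (S ^ 6 * (∫ x, ‖fderiv ℝ g x‖ ^ 2) ^ 3) := by
        gcongr
        exact integral_norm_pow_six_le g hgd hgc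
    _ ≤ K ^ 6 * ((S + 1) ^ 6 * (4 * (L + K) ^ 2 * 4 * wsq 1 δ f) ^ 3) := by
        gcongr
        linarith
    _ = _ := by ring

lemma integral_mul_le_sqrt_mul_sqrt {A B : EuclideanSpace ℝ (Fin 3) → ℝ}
    (hA : Continuous A) (hAc : HasCompactSupport A) (hA0 : ∀ x, 0 ≤ A x)
    (hB : Continuous B) (hBc : HasCompactSupport B) (hB0 : ∀ x, 0 ≤ B x) :
    ∫ x, A x * B x ≤ √(∫ x, A x ^ 2) * √(∫ x, B x ^ 2) := by
  have h := integral_mul_le_Lp_mul_Lq_of_nonneg (μ := volume) Real.HolderConjugate.two_two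
    (Filter.Eventually.of_forall hA0) (Filter.Eventually.of_forall hB0)
    (hA.memLp_of_hasCompactSupport hAc) (hB.memLp_of_hasCompactSupport hBc)
  simpa only [Real.rpow_two, ← Real.sqrt_eq_rpow] using h

lemma hasCompactSupport_weight_pow {f : EuclideanSpace ℝ (Fin 3) → ℝ}
    (hc : HasCompactSupport f) (δ : ℝ) {n : ℕ} (hn : n ≠ 0) :
    HasCompactSupport fun x => ((1 + ‖x‖) ^ δ * ‖f x‖) ^ n := by
  refine hc.mono fun x hx => ?_
  contrapose! hx
  simp only [Function.mem_support, not_not] at hx ⊢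
  simp [hx, hn]

lemma continuous_weight_pow {f : EuclideanSpace ℝ (Fin 3) → ℝ} (hf : Continuous f)
    (δ : ℝ) (n : ℕ) : Continuous fun x => ((1 + ‖x‖) ^ δ * ‖f x‖) ^ n :=
  ((continuous_weight δ).mul hf.norm).pow n

/-- The weighted `L⁴` norm is controlled by the weighted `H¹` norm. -/
lemma exists_integral_weight_pow_four_le (δ : ℝ) : ∃ C : ℝ, 0 < C ∧
    ∀ f : EuclideanSpace ℝ (Fin 3) → ℝ, IsTest f →
      ∫ x, ((1 + ‖x‖) ^ (δ + 3 / 4) * ‖f x‖) ^ 4 ≤ C * wsq 1 δ f ^ 2 := by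
  obtain ⟨C, hC, h⟩ := exists_integral_weight_pow_six_le δ
  refine ⟨√C, Real.sqrt_pos.2 hC, fun f hf => ?_⟩
  have hE := wsq_nonneg 1 δ f
  have hcs := integral_mul_le_sqrt_mul_sqrt
    (continuous_weight_pow hf.continuous δ 1) (hasCompactSupport_weight_pow hf.2 δ one_ne_zero)
    (fun x => by positivity)
    (continuous_weight_pow hf.continuous (δ + 1) 3)
    (hasCompactSupport_weight_pow hf.2 (δ + 1) three_ne_zero) (fun x => by positivity)
  have e : ∀ x : EuclideanSpace ℝ (Fin 3), ((1 + ‖x‖) ^ (δ + 3 / 4) * ‖f x‖) ^ 4 =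
      ((1 + ‖x‖) ^ δ * ‖f x‖) ^ 1 * ((1 + ‖x‖) ^ (δ + 1) * ‖f x‖) ^ 3 := by
    intro x
    have hp : 0 < 1 + ‖x‖ := by positivity
    have : ((1 + ‖x‖) ^ (δ + 3 / 4)) ^ 4 = (1 + ‖x‖) ^ δ * ((1 + ‖x‖) ^ (δ + 1)) ^ 3 := by
      simp only [← Real.rpow_natCast, ← Real.rpow_mul hp.le, ← Real.rpow_add hp]
      congr 1; push_cast; ring
    rw [mul_pow, this]; ring
  simp only [← e, ← pow_mul] at hcs
  refine hcs.trans ?_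
  have h1 : √(∫ x : EuclideanSpace ℝ (Fin 3), ((1 + ‖x‖) ^ δ * ‖f x‖) ^ (1 * 2)) ≤
      √(wsq 1 δ f) := Real.sqrt_le_sqrt (wL2_le_wsq_one δ f)
  have h2 : √(∫ x : EuclideanSpace ℝ (Fin 3), ((1 + ‖x‖) ^ (δ + 1) * ‖f x‖) ^ (3 * 2)) ≤
      √(C * wsq 1 δ f ^ 3) := Real.sqrt_le_sqrt (h f hf)
  calc _ ≤ √(wsq 1 δ f) * √(C * wsq 1 δ f ^ 3) := by gcongr
    _ = √(C * (wsq 1 δ f ^ 2) ^ 2) := by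
        rw [← Real.sqrt_mul hE]; congr 1; ring
    _ = _ := by rw [Real.sqrt_mul hC.le, Real.sqrt_sq (by positivity)]

lemma exists_wL2_mul_le_wsq_one_mul_wsq_one {δ δ₁ δ₂ : ℝ} (hδ : δ - 3 / 2 ≤ δ₁ + δ₂) :
    ∃ C : ℝ, 0 < C ∧ ∀ f g : EuclideanSpace ℝ (Fin 3) → ℝ, IsTest f → IsTest g →
      wL2 δ (fun x => f x * g x) ≤ C * wsq 1 δ₁ f * wsq 1 δ₂ g := by
  obtain ⟨C₁, hC₁, h₁⟩ := exists_integral_weight_pow_four_le δ₁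
  obtain ⟨C₂, hC₂, h₂⟩ := exists_integral_weight_pow_four_le δ₂
  refine ⟨√C₁ * √C₂, by positivity, fun f g hf hg => ?_⟩
  have hE₁ := wsq_nonneg 1 δ₁ f
  have hE₂ := wsq_nonneg 1 δ₂ g
  have hcs := integral_mul_le_sqrt_mul_sqrt
    (continuous_weight_pow hf.continuous (δ₁ + 3 / 4) 2)
    (hasCompactSupport_weight_pow hf.2 (δ₁ + 3 / 4) two_ne_zero) (fun x => by positivity)
    (continuous_weight_pow hg.continuous (δ₂ + 3 / 4) 2)
    (hasCompactSupport_weight_pow hg.2 (δ₂ + 3 / 4) two_ne_zero) (fun x => by positivity)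
  simp only [← pow_mul] at hcs
  calc wL2 δ (fun x => f x * g x) ≤ ∫ x : EuclideanSpace ℝ (Fin 3),
        ((1 + ‖x‖) ^ (δ₁ + 3 / 4) * ‖f x‖) ^ 2 * ((1 + ‖x‖) ^ (δ₂ + 3 / 4) * ‖g x‖) ^ 2 := by
        refine integral_mono
          (integrable_weight_pow (hf.mul hg).continuous (hf.mul hg).2 δ two_ne_zero)
          (((continuous_weight_pow hf.continuous _ 2).mul
            (continuous_weight_pow hg.continuous _ 2)).integrable_of_hasCompactSupport
            (hasCompactSupport_weight_pow hf.2 _ two_ne_zero).mul_right) fun x => ?_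
        simp only
        rw [← mul_pow]
        refine pow_le_pow_left₀ (by positivity) ?_ 2
        have hw : (1 + ‖x‖) ^ δ ≤ (1 + ‖x‖) ^ (δ₁ + 3 / 4) * (1 + ‖x‖) ^ (δ₂ + 3 / 4) := by
          rw [← Real.rpow_add (by positivity)]
          exact Real.rpow_le_rpow_of_exponent_le (by linarith [norm_nonneg x]) (by linarith)
        rw [norm_mul, mul_mul_mul_comm]
        gcongr
    _ ≤ _ := hcs
    _ ≤ √(C₁ * wsq 1 δ₁ f ^ 2) * √(C₂ * wsq 1 δ₂ g ^ 2) := by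
        gcongr
        · exact h₁ f hf
        · exact h₂ g hg
    _ = _ := by
        rw [Real.sqrt_mul hC₁.le, Real.sqrt_mul hC₂.le, Real.sqrt_sq hE₁, Real.sqrt_sq hE₂]
        ring

lemma exists_setIntegral_ball_le (δ : ℝ) : ∃ C : ℝ, 0 < C ∧
    ∀ f : EuclideanSpace ℝ (Fin 3) → ℝ, IsTest f → ∀ x : EuclideanSpace ℝ (Fin 3), ∀ t : ℝ,
      0 < t → t ≤ 1 →
      ∫ z in Metric.ball (0 : EuclideanSpace ℝ (Fin 3)) 1, ‖f (x + (t * ((1 + ‖x‖) / 2)) • z)‖ ≤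
        C * t ^ (-(1 / 2) : ℝ) * (1 + ‖x‖) ^ (-(δ + 3 / 2)) * √(wsq 1 δ f) := by
  obtain ⟨C, hC, h⟩ := exists_integral_weight_pow_six_le δ
  set V : ℝ := volume.real (Metric.ball (0 : EuclideanSpace ℝ (Fin 3)) 1) with hV
  have hV0 : 0 < V :=
    ENNReal.toReal_pos (Metric.measure_ball_pos volume _ one_pos).ne' measure_ball_lt_top.ne
  set K : ℝ := 2 ^ |δ + 1| with hK
  have hK0 : 0 < K := by positivity
  set D : ℝ := K * (8 * C) ^ (1 / 6 : ℝ) with hD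
  have hD0 : 0 < D := by positivity
  refine ⟨V ^ (5 / 6 : ℝ) * D, by positivity, fun f hf x t ht ht1 => ?_⟩
  set w : ℝ := 1 + ‖x‖ with hw
  have hx0 := norm_nonneg x
  have hw0 : 0 < w := by positivity
  set s : ℝ := t * (w / 2) with hs
  have hs0 : 0 < s := by positivity
  have hsw : s ≤ w / 2 := by rw [hs]; nlinarith
  have hE := wsq_nonneg 1 δ f
  set G : EuclideanSpace ℝ (Fin 3) → ℝ := fun y => ((1 + ‖y‖) ^ (δ + 1) * ‖f y‖) ^ 6 with hG
  have hGi : Integrable G := integrable_weight_pow hf.continuous hf.2 _ (by norm_num)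
  have hG0 : ∀ y, 0 ≤ G y := fun y => by positivity
  have hGs : Integrable fun z => G (x + s • z) :=
    (hGi.comp_add_left x).comp_smul hs0.ne'
  have hcont : Continuous fun z => f (x + s • z) := hf.continuous.comp (by fun_prop)
  obtain ⟨M, hM⟩ := hf.2.exists_bound_of_continuous hf.continuous
  have hfin : IsFiniteMeasure
      (volume.restrict (Metric.ball (0 : EuclideanSpace ℝ (Fin 3)) 1)) :=
    ⟨by simp⟩
  -- scaling estimate for the sixth power
  have hsix : ∫ z in Metric.ball (0 : EuclideanSpace ℝ (Fin 3)) 1, ‖f (x + s • z)‖ ^ 6 ≤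
      (D * t ^ (-(1 / 2) : ℝ) * w ^ (-(δ + 3 / 2)) * √(wsq 1 δ f)) ^ 6 := by
    calc _ ≤ ∫ z in Metric.ball (0 : EuclideanSpace ℝ (Fin 3)) 1,
          (K * w ^ (-(δ + 1))) ^ 6 * G (x + s • z) := by
          refine integral_mono_of_nonneg (Filter.Eventually.of_forall fun z => by positivity)
            (hGs.const_mul _).integrableOn
            ((ae_restrict_mem measurableSet_ball).mono fun z hz => ?_)
          simp only [hG]
          rw [← mul_pow]
          refine pow_le_pow_left₀ (norm_nonneg _) ?_ 6
          rw [mem_ball_zero_iff] at hz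
          have hsz : ‖s • z‖ ≤ w / 2 := by
            rw [norm_smul, Real.norm_of_nonneg hs0.le]
            nlinarith [norm_nonneg z]
          have hu : 1 + ‖x + s • z‖ ≤ 2 * w := by
            have := norm_add_le x (s • z)
            linarith
          have hl : w ≤ 2 * (1 + ‖x + s • z‖) := by
            have := norm_le_add_norm_add x (s • z)
            linarith
          have hp := rpow_le_rpow_of_comparable hw0
            (show 0 < 1 + ‖x + s • z‖ by positivity) two_pos hl hu (δ + 1)
          calc ‖f (x + s • z)‖ = w ^ (-(δ + 1)) * w ^ (δ + 1) * ‖f (x + s • z)‖ := by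
                rw [← Real.rpow_add hw0]; simp
            _ ≤ w ^ (-(δ + 1)) * (K * (1 + ‖x + s • z‖) ^ (δ + 1)) * ‖f (x + s • z)‖ := by
                gcongr
            _ = _ := by ring
      _ ≤ ∫ z, (K * w ^ (-(δ + 1))) ^ 6 * G (x + s • z) :=
          setIntegral_le_integral (hGs.const_mul _)
            (Filter.Eventually.of_forall fun z => mul_nonneg (by positivity) (hG0 _))
      _ = (K * w ^ (-(δ + 1))) ^ 6 * ((s ^ 3)⁻¹ * ∫ y, G y) := by
          rw [integral_const_mul,
            Measure.integral_comp_smul_of_nonneg volume (fun y => G (x + y)) s (hR := hs0.le),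
            integral_add_left_eq_self]
          simp
      _ ≤ (K * w ^ (-(δ + 1))) ^ 6 * ((s ^ 3)⁻¹ * (C * wsq 1 δ f ^ 3)) := by
          gcongr
          exact h f hf
      _ = _ := by
          have e1 : √(wsq 1 δ f) ^ 6 = wsq 1 δ f ^ 3 := by
            rw [show 6 = 2 * 3 from rfl, pow_mul, Real.sq_sqrt hE]
          have e2 : (t ^ (-(1 / 2) : ℝ)) ^ 6 = (t ^ 3)⁻¹ := by
            rw [← Real.rpow_natCast, ← Real.rpow_natCast, ← Real.rpow_mul ht.le,
              ← Real.rpow_neg ht.le]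
            congr 1; push_cast; ring
          have e3 : ((8 * C) ^ (1 / 6 : ℝ)) ^ 6 = 8 * C := by
            rw [← Real.rpow_natCast, ← Real.rpow_mul (by positivity)]
            norm_num
          have e4 : (w ^ (-(δ + 3 / 2))) ^ 6 = (w ^ (-(δ + 1))) ^ 6 * (w ^ 3)⁻¹ := by
            rw [← Real.rpow_natCast, ← Real.rpow_natCast, ← Real.rpow_natCast,
              ← Real.rpow_neg hw0.le, ← Real.rpow_mul hw0.le, ← Real.rpow_mul hw0.le,
              ← Real.rpow_add hw0]
            congr 1; push_cast; ring
          simp only [mul_pow, hD, e1, e2, e3, e4, hs]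
          field_simp
          ring
  have hhol := integral_mul_le_Lp_mul_Lq_of_nonneg
    (μ := volume.restrict (Metric.ball (0 : EuclideanSpace ℝ (Fin 3)) 1))
    (p := 6 / 5) (q := 6) (Real.holderConjugate_iff.2 ⟨by norm_num, by norm_num⟩)
    (f := fun _ => (1 : ℝ)) (g := fun z => ‖f (x + s • z)‖)
    (Filter.Eventually.of_forall fun _ => zero_le_one)
    (Filter.Eventually.of_forall fun _ => norm_nonneg _)
    (memLp_const 1)
    (MemLp.of_bound hcont.norm.aestronglyMeasurable M
      (Filter.Eventually.of_forall fun z => by rw [norm_norm]; exact hM _))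
  have hR0 : 0 ≤ D * t ^ (-(1 / 2) : ℝ) * w ^ (-(δ + 3 / 2)) * √(wsq 1 δ f) := by positivity
  simp only [one_mul, Real.one_rpow, integral_const, smul_eq_mul, mul_one] at hhol
  refine hhol.trans ?_
  have hVe : (volume.restrict (Metric.ball (0 : EuclideanSpace ℝ (Fin 3)) 1)).real Set.univ = V := by
    simp [hV]
  rw [hVe, show (1 / (6 / 5) : ℝ) = 5 / 6 by norm_num]
  have h6 : (∫ z in Metric.ball (0 : EuclideanSpace ℝ (Fin 3)) 1,
      ‖f (x + s • z)‖ ^ (6 : ℝ)) ^ (1 / 6 : ℝ) ≤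
      D * t ^ (-(1 / 2) : ℝ) * w ^ (-(δ + 3 / 2)) * √(wsq 1 δ f) := by
    have hc : ∀ z, ‖f (x + s • z)‖ ^ (6 : ℝ) = ‖f (x + s • z)‖ ^ 6 := fun z => by
      rw [← Real.rpow_natCast]; norm_num
    simp only [hc]
    calc _ ≤ ((D * t ^ (-(1 / 2) : ℝ) * w ^ (-(δ + 3 / 2)) * √(wsq 1 δ f)) ^ 6) ^ (1 / 6 : ℝ) :=
          Real.rpow_le_rpow (by positivity) hsix (by norm_num)
      _ = _ := by
          rw [← Real.rpow_natCast, ← Real.rpow_mul hR0]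
          norm_num
  calc _ ≤ V ^ (5 / 6 : ℝ) * (D * t ^ (-(1 / 2) : ℝ) * w ^ (-(δ + 3 / 2)) * √(wsq 1 δ f)) := by
        gcongr
    _ = _ := by ring

lemma norm_le_norm_add_integral {f : EuclideanSpace ℝ (Fin 3) → ℝ} (hf : IsTest f)
    (x z : EuclideanSpace ℝ (Fin 3)) {R : ℝ} (hR : 0 ≤ R) (hz : ‖z‖ ≤ 1) :
    ‖f x‖ ≤ ‖f (x + R • z)‖ +
      ∫ t in Set.Ioc (0 : ℝ) 1, R * ∑ i, ‖pderiv3 i f (x + (t * R) • z)‖ := by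
  have hd : ∀ t : ℝ, HasDerivAt (fun t : ℝ => f (x + (t * R) • z))
      (fderiv ℝ f (x + (t * R) • z) (R • z)) t := by
    intro t
    have h1 : HasDerivAt (fun t : ℝ => x + (t * R) • z) (R • z) t := by
      have := (((hasDerivAt_id t).mul_const R).smul_const z).const_add x
      simpa using this
    exact (hf.differentiable _).hasFDerivAt.comp_hasDerivAt t h1
  have hc : Continuous fun t : ℝ => fderiv ℝ f (x + (t * R) • z) (R • z) := by
    have := hf.1.continuous_fderiv (by simp)
    fun_prop
  have hi : Continuous fun t : ℝ => R * ∑ i, ‖pderiv3 i f (x + (t * R) • z)‖ := by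
    have := fun i => (hf.pderiv3 i).continuous
    fun_prop
  have hftc := intervalIntegral.integral_eq_sub_of_hasDerivAt (a := 0) (b := 1)
    (fun t _ => hd t) (hc.intervalIntegrable _ _)
  simp only [one_mul, zero_mul, zero_smul, add_zero] at hftc
  have hb : ‖∫ t in (0 : ℝ)..1, fderiv ℝ f (x + (t * R) • z) (R • z)‖ ≤
      ∫ t in (0 : ℝ)..1, R * ∑ i, ‖pderiv3 i f (x + (t * R) • z)‖ := by
    refine intervalIntegral.norm_integral_le_of_norm_le zero_le_one
      (Filter.Eventually.of_forall fun t _ => ?_) (hi.intervalIntegrable _ _)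
    calc _ ≤ ‖fderiv ℝ f (x + (t * R) • z)‖ * ‖R • z‖ := ContinuousLinearMap.le_opNorm _ _
      _ ≤ (∑ i, ‖pderiv3 i f (x + (t * R) • z)‖) * (R * 1) := by
          refine mul_le_mul (norm_le_sum_norm_apply_single _) ?_ (norm_nonneg _) (by positivity)
          rw [norm_smul, Real.norm_of_nonneg hR]
          gcongr
      _ = _ := by ring
  rw [hftc, intervalIntegral.integral_of_le zero_le_one] at hb
  have := norm_sub_norm_le (f x) (f (x + R • z))
  rw [norm_sub_rev] at this
  linarith

/-- Weighted Sobolev embedding of `H²` into the bounded functions. -/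
lemma exists_weight_mul_norm_le (δ : ℝ) : ∃ C : ℝ, 0 < C ∧
    ∀ f : EuclideanSpace ℝ (Fin 3) → ℝ, IsTest f → ∀ x : EuclideanSpace ℝ (Fin 3),
      (1 + ‖x‖) ^ (δ + 3 / 2) * ‖f x‖ ≤ C * √(wsq 2 δ f) := by
  obtain ⟨C₀, hC₀, h₀⟩ := exists_setIntegral_ball_le δ
  obtain ⟨C₁, hC₁, h₁⟩ := exists_setIntegral_ball_le (δ + 1)
  set B := Metric.ball (0 : EuclideanSpace ℝ (Fin 3)) 1 with hB
  set V : ℝ := volume.real B with hV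
  have hV0 : 0 < V :=
    ENNReal.toReal_pos (Metric.measure_ball_pos volume _ one_pos).ne' measure_ball_lt_top.ne
  have hfin : IsFiniteMeasure (volume.restrict B) := ⟨by simp [hB]⟩
  refine ⟨V⁻¹ * (C₀ * √8 + 3 * C₁ * √8), by positivity, fun f hf x => ?_⟩
  set w : ℝ := 1 + ‖x‖ with hw
  have hw0 : 0 < w := by positivity
  set R : ℝ := w / 2 with hR
  have hR0 : 0 < R := by positivity
  have hE2 := wsq_nonneg 2 δ f
  have hs0 : √(wsq 1 δ f) ≤ √8 * √(wsq 2 δ f) := by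
    rw [← Real.sqrt_mul (by norm_num)]
    refine Real.sqrt_le_sqrt ((wsq_mono one_le_two δ f).trans (le_of_eq ?_))
    norm_num
  have hs1 : ∀ i, √(wsq 1 (δ + 1) (pderiv3 i f)) ≤ √8 * √(wsq 2 δ f) := by
    intro i
    rw [← Real.sqrt_mul (by norm_num)]
    refine Real.sqrt_le_sqrt ((wsq_pderiv3_le hf 1 δ i).trans (le_of_eq ?_))
    norm_num
  -- joint integrability of the derivative terms
  have hprod : ∀ i, Integrable (Function.uncurry fun (z : EuclideanSpace ℝ (Fin 3)) (t : ℝ) =>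
      ‖pderiv3 i f (x + (t * R) • z)‖)
      ((volume.restrict B).prod (volume.restrict (Set.Ioc (0 : ℝ) 1))) := by
    intro i
    obtain ⟨M, hM⟩ := (hf.pderiv3 i).2.exists_bound_of_continuous (hf.pderiv3 i).continuous
    refine Integrable.of_bound (C := M) ?_ (Filter.Eventually.of_forall fun p => ?_)
    · have := (hf.pderiv3 i).continuous
      refine Continuous.aestronglyMeasurable ?_
      unfold Function.uncurry
      fun_prop
    · simp only [Function.uncurry, norm_norm]
      exact hM _
  have hsum : Integrable (Function.uncurry fun (z : EuclideanSpace ℝ (Fin 3)) (t : ℝ) =>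
      R * ∑ i, ‖pderiv3 i f (x + (t * R) • z)‖)
      ((volume.restrict B).prod (volume.restrict (Set.Ioc (0 : ℝ) 1))) :=
    (integrable_finsetSum Finset.univ fun i _ => hprod i).const_mul R
  have hfi : Integrable (fun z => ‖f (x + R • z)‖) (volume.restrict B) := by
    obtain ⟨M, hM⟩ := hf.2.exists_bound_of_continuous hf.continuous
    have := hf.continuous
    refine Integrable.of_bound (C := M) (Continuous.aestronglyMeasurable (by fun_prop))
      (Filter.Eventually.of_forall fun z => ?_)
    rw [norm_norm]
    exact hM _
  have hint : V * ‖f x‖ ≤ (∫ z in B, ‖f (x + R • z)‖) +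
      ∫ t in Set.Ioc (0 : ℝ) 1, R * ∑ i, ∫ z in B, ‖pderiv3 i f (x + (t * R) • z)‖ := by
    calc V * ‖f x‖ = ∫ z in B, ‖f x‖ := by simp [hV]
      _ ≤ ∫ z in B, (‖f (x + R • z)‖ +
          ∫ t in Set.Ioc (0 : ℝ) 1, R * ∑ i, ‖pderiv3 i f (x + (t * R) • z)‖) := by
          refine integral_mono_of_nonneg (Filter.Eventually.of_forall fun _ => norm_nonneg _)
            (hfi.add hsum.integral_prod_left) ?_
          refine (ae_restrict_mem measurableSet_ball).mono fun z hz => ?_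
          exact norm_le_norm_add_integral hf x z hR0.le (mem_ball_zero_iff.1 hz).le
      _ = (∫ z in B, ‖f (x + R • z)‖) + ∫ z in B,
          ∫ t in Set.Ioc (0 : ℝ) 1, R * ∑ i, ‖pderiv3 i f (x + (t * R) • z)‖ :=
          integral_add hfi hsum.integral_prod_left
      _ = _ := by
          rw [integral_integral_swap hsum]
          congr 1
          refine integral_congr_ae (hsum.prod_left_ae.mono fun t _ => ?_)
          simp only
          rw [integral_const_mul, integral_finsetSum]
          intro i _
          obtain ⟨M, hM⟩ := (hf.pderiv3 i).2.exists_bound_of_continuous (hf.pderiv3 i).continuous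
          have := (hf.pderiv3 i).continuous
          refine Integrable.of_bound (C := M) (Continuous.aestronglyMeasurable (by fun_prop))
            (Filter.Eventually.of_forall fun z => ?_)
          rw [norm_norm]
          exact hM _
  have hfirst : ∫ z in B, ‖f (x + R • z)‖ ≤
      C₀ * √8 * (w ^ (-(δ + 3 / 2)) * √(wsq 2 δ f)) := by
    have := h₀ f hf x 1 one_pos le_rfl
    rw [one_mul, Real.one_rpow, mul_one] at this
    refine this.trans ?_
    calc _ ≤ C₀ * w ^ (-(δ + 3 / 2)) * (√8 * √(wsq 2 δ f)) := by gcongr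
      _ = _ := by ring
  have hrpow : ∫ t in Set.Ioc (0 : ℝ) 1, t ^ (-(1 / 2) : ℝ) = 2 := by
    rw [← intervalIntegral.integral_of_le zero_le_one, integral_rpow (Or.inl (by norm_num))]
    norm_num
  have hrpowi : IntegrableOn (fun t : ℝ => t ^ (-(1 / 2) : ℝ)) (Set.Ioc 0 1) :=
    (intervalIntegrable_iff_integrableOn_Ioc_of_le zero_le_one).1
      (intervalIntegral.intervalIntegrable_rpow' (by norm_num))
  have hsecond : ∫ t in Set.Ioc (0 : ℝ) 1, R * ∑ i, ∫ z in B,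
      ‖pderiv3 i f (x + (t * R) • z)‖ ≤
      3 * C₁ * √8 * (w ^ (-(δ + 3 / 2)) * √(wsq 2 δ f)) := by
    calc _ ≤ ∫ t in Set.Ioc (0 : ℝ) 1, (R * (3 * (C₁ * w ^ (-(δ + 1 + 3 / 2)) *
          (√8 * √(wsq 2 δ f))))) * t ^ (-(1 / 2) : ℝ) := by
          refine integral_mono_of_nonneg (Filter.Eventually.of_forall fun t => by positivity)
            (hrpowi.const_mul _) ((ae_restrict_mem measurableSet_Ioc).mono fun t ht => ?_)
          have ht0 : 0 < t := ht.1
          simp only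
          rw [mul_assoc R]
          refine mul_le_mul_of_nonneg_left ?_ hR0.le
          calc _ ≤ ∑ _i : Fin 3, C₁ * t ^ (-(1 / 2) : ℝ) * w ^ (-(δ + 1 + 3 / 2)) *
                (√8 * √(wsq 2 δ f)) := by
                refine Finset.sum_le_sum fun i _ => ?_
                refine (h₁ _ (hf.pderiv3 i) x t ht0 ht.2).trans ?_
                gcongr
                exact hs1 i
            _ = _ := by
                rw [Finset.sum_const, Finset.card_univ, Fintype.card_fin, nsmul_eq_mul]
                push_cast; ring
      _ = _ := by
          have e : w ^ (-(δ + 3 / 2)) = w * w ^ (-(δ + 1 + 3 / 2)) := by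
            nth_rewrite 2 [← Real.rpow_one w]
            rw [← Real.rpow_add hw0]
            congr 1; ring
          rw [integral_const_mul, hrpow, e, hR]
          ring
  have hfin2 : V * ‖f x‖ ≤ (C₀ * √8 + 3 * C₁ * √8) * (w ^ (-(δ + 3 / 2)) * √(wsq 2 δ f)) := by
    linarith
  calc w ^ (δ + 3 / 2) * ‖f x‖ = V⁻¹ * w ^ (δ + 3 / 2) * (V * ‖f x‖) := by
        field_simp
    _ ≤ V⁻¹ * w ^ (δ + 3 / 2) *
        ((C₀ * √8 + 3 * C₁ * √8) * (w ^ (-(δ + 3 / 2)) * √(wsq 2 δ f))) := by gcongr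
    _ = (w ^ (δ + 3 / 2) * w ^ (-(δ + 3 / 2))) *
        (V⁻¹ * (C₀ * √8 + 3 * C₁ * √8) * √(wsq 2 δ f)) := by ring
    _ = _ := by rw [← Real.rpow_add hw0, add_neg_cancel, Real.rpow_zero, one_mul]

lemma exists_wL2_mul_le_wsq_two_mul_wL2 {δ δ₁ δ₂ : ℝ} (hδ : δ - 3 / 2 ≤ δ₁ + δ₂) :
    ∃ C : ℝ, 0 < C ∧ ∀ f g : EuclideanSpace ℝ (Fin 3) → ℝ, IsTest f → IsTest g →
      wL2 δ (fun x => f x * g x) ≤ C * wsq 2 δ₁ f * wL2 δ₂ g := by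
  obtain ⟨C, hC, h⟩ := exists_weight_mul_norm_le δ₁
  refine ⟨C ^ 2, by positivity, fun f g hf hg => ?_⟩
  have hE := wsq_nonneg 2 δ₁ f
  unfold wL2
  rw [← integral_const_mul]
  refine integral_mono (integrable_weight_pow (hf.mul hg).continuous (hf.mul hg).2 δ two_ne_zero)
    ((integrable_weight_pow hg.continuous hg.2 δ₂ two_ne_zero).const_mul _) fun x => ?_
  have hw : (1 + ‖x‖) ^ δ ≤ (1 + ‖x‖) ^ (δ₁ + 3 / 2) * (1 + ‖x‖) ^ δ₂ := by
    rw [← Real.rpow_add (by positivity)]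
    exact Real.rpow_le_rpow_of_exponent_le (by linarith [norm_nonneg x]) (by linarith)
  simp only
  calc ((1 + ‖x‖) ^ δ * ‖f x * g x‖) ^ 2
      ≤ ((C * √(wsq 2 δ₁ f)) * ((1 + ‖x‖) ^ δ₂ * ‖g x‖)) ^ 2 := by
        refine pow_le_pow_left₀ (by positivity) ?_ 2
        calc (1 + ‖x‖) ^ δ * ‖f x * g x‖
            ≤ ((1 + ‖x‖) ^ (δ₁ + 3 / 2) * (1 + ‖x‖) ^ δ₂) * (‖f x‖ * ‖g x‖) := by
              rw [norm_mul]; gcongr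
          _ = ((1 + ‖x‖) ^ (δ₁ + 3 / 2) * ‖f x‖) * ((1 + ‖x‖) ^ δ₂ * ‖g x‖) := by ring
          _ ≤ _ := mul_le_mul_of_nonneg_right (h f hf x) (by positivity)
    _ = _ := by rw [mul_pow, mul_pow C, Real.sq_sqrt hE]

/-- Square-integrability of products: the case of no derivatives. -/
lemma exists_wL2_mul_le {k₁ k₂ : ℕ} (hk : 2 ≤ k₁ + k₂) {δ δ₁ δ₂ : ℝ}
    (hδ : δ - 3 / 2 ≤ δ₁ + δ₂) :
    ∃ C : ℝ, 0 < C ∧ ∀ f g : EuclideanSpace ℝ (Fin 3) → ℝ, IsTest f → IsTest g →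
      wL2 δ (fun x => f x * g x) ≤ C * wsq k₁ δ₁ f * wsq k₂ δ₂ g := by
  have mono : ∀ {m₁ m₂ : ℕ}, m₁ ≤ k₁ → m₂ ≤ k₂ →
      (∃ C : ℝ, 0 < C ∧ ∀ f g : EuclideanSpace ℝ (Fin 3) → ℝ, IsTest f → IsTest g →
        wL2 δ (fun x => f x * g x) ≤ C * wsq m₁ δ₁ f * wsq m₂ δ₂ g) →
      ∃ C : ℝ, 0 < C ∧ ∀ f g : EuclideanSpace ℝ (Fin 3) → ℝ, IsTest f → IsTest g →
        wL2 δ (fun x => f x * g x) ≤ C * wsq k₁ δ₁ f * wsq k₂ δ₂ g := by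
    rintro m₁ m₂ hm₁ hm₂ ⟨C, hC, h⟩
    refine ⟨C * ((m₁ : ℝ) + 1) ^ 3 * ((m₂ : ℝ) + 1) ^ 3, by positivity, fun f g hf hg => ?_⟩
    have h1 := wsq_nonneg m₂ δ₂ g
    have h2 := wsq_nonneg k₁ δ₁ f
    calc _ ≤ C * wsq m₁ δ₁ f * wsq m₂ δ₂ g := h f g hf hg
      _ ≤ C * (((m₁ : ℝ) + 1) ^ 3 * wsq k₁ δ₁ f) * (((m₂ : ℝ) + 1) ^ 3 * wsq k₂ δ₂ g) := by
          gcongr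
          · exact wsq_mono hm₁ δ₁ f
          · exact wsq_mono hm₂ δ₂ g
      _ = _ := by ring
  rcases Nat.lt_or_ge k₁ 1 with h1 | h1
  · refine mono (Nat.zero_le k₁) (show 2 ≤ k₂ by omega) ?_
    obtain ⟨C, hC, h⟩ := exists_wL2_mul_le_wsq_two_mul_wL2 (δ := δ) (δ₁ := δ₂) (δ₂ := δ₁)
      (by linarith)
    refine ⟨C, hC, fun f g hf hg => ?_⟩
    have := h g f hg hf
    simp only [mul_comm (g _)] at this
    rw [wsq_zero]
    linarith
  · rcases Nat.lt_or_ge k₂ 1 with h2 | h2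
    · refine mono (show 2 ≤ k₁ by omega) (Nat.zero_le k₂) ?_
      simpa only [wsq_zero] using exists_wL2_mul_le_wsq_two_mul_wL2 hδ
    · exact mono h1 h2 (exists_wL2_mul_le_wsq_one_mul_wsq_one hδ)

lemma exists_wsq_mul_le (k : ℕ) : ∀ (k₁ k₂ : ℕ) (_ : k ≤ k₁) (_ : k ≤ k₂)
    (_ : k + 2 ≤ k₁ + k₂) (δ δ₁ δ₂ : ℝ) (_ : δ - 3 / 2 ≤ δ₁ + δ₂),
    ∃ C : ℝ, 0 < C ∧ ∀ f g : EuclideanSpace ℝ (Fin 3) → ℝ, IsTest f → IsTest g →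
      wsq k δ (fun x => f x * g x) ≤ C * wsq k₁ δ₁ f * wsq k₂ δ₂ g := by
  induction k with
  | zero =>
    intro k₁ k₂ _ _ hk δ δ₁ δ₂ hδ
    simpa only [wsq_zero] using exists_wL2_mul_le (by omega : 2 ≤ k₁ + k₂) hδ
  | succ k ih =>
    intro k₁ k₂ h₁ h₂ hk δ δ₁ δ₂ hδ
    obtain ⟨l₁, rfl⟩ : ∃ l₁, k₁ = l₁ + 1 := ⟨k₁ - 1, by omega⟩
    obtain ⟨l₂, rfl⟩ : ∃ l₂, k₂ = l₂ + 1 := ⟨k₂ - 1, by omega⟩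
    obtain ⟨C₀, hC₀, H₀⟩ := exists_wL2_mul_le (by omega : 2 ≤ (l₁ + 1) + (l₂ + 1)) hδ
    obtain ⟨C₁, hC₁, H₁⟩ := ih l₁ (l₂ + 1) (by omega) (by omega) (by omega) (δ + 1) (δ₁ + 1) δ₂
      (by linarith)
    obtain ⟨C₂, hC₂, H₂⟩ := ih (l₁ + 1) l₂ (by omega) (by omega) (by omega) (δ + 1) δ₁ (δ₂ + 1)
      (by linarith)
    set D₁ : ℝ := ((l₁ : ℝ) + 1) ^ 3
    set D₂ : ℝ := ((l₂ : ℝ) + 1) ^ 3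
    have hD₁ : 0 < D₁ := by positivity
    have hD₂ : 0 < D₂ := by positivity
    refine ⟨((k : ℝ) + 2) ^ 3 * (C₀ + 3 * (((k : ℝ) + 1) ^ 3 * (2 * (C₁ * D₁ + C₂ * D₂)))),
      by positivity, fun f g hf hg => ?_⟩
    have hF := wsq_nonneg (l₁ + 1) δ₁ f
    have hG := wsq_nonneg (l₂ + 1) δ₂ g
    have hi : ∀ i, wsq k (δ + 1) (pderiv3 i fun x => f x * g x) ≤ ((k : ℝ) + 1) ^ 3 *
        (2 * (C₁ * D₁ + C₂ * D₂)) * (wsq (l₁ + 1) δ₁ f * wsq (l₂ + 1) δ₂ g) := by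
      intro i
      rw [pderiv3_mul hf hg]
      refine (wsq_add_le ((hf.pderiv3 i).mul hg) (hf.mul (hg.pderiv3 i)) k (δ + 1)).trans ?_
      have a₁ : wsq k (δ + 1) (fun x => pderiv3 i f x * g x) ≤
          C₁ * (D₁ * wsq (l₁ + 1) δ₁ f) * wsq (l₂ + 1) δ₂ g := by
        refine (H₁ _ _ (hf.pderiv3 i) hg).trans ?_
        gcongr
        exact wsq_pderiv3_le hf l₁ δ₁ i
      have a₂ : wsq k (δ + 1) (fun x => f x * pderiv3 i g x) ≤
          C₂ * wsq (l₁ + 1) δ₁ f * (D₂ * wsq (l₂ + 1) δ₂ g) := by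
        refine (H₂ _ _ hf (hg.pderiv3 i)).trans ?_
        gcongr
        exact wsq_pderiv3_le hg l₂ δ₂ i
      calc _ ≤ ((k : ℝ) + 1) ^ 3 * (2 * (C₁ * (D₁ * wsq (l₁ + 1) δ₁ f) * wsq (l₂ + 1) δ₂ g +
            C₂ * wsq (l₁ + 1) δ₁ f * (D₂ * wsq (l₂ + 1) δ₂ g))) := by gcongr
        _ = _ := by ring
    refine (wsq_succ_le (hf.mul hg) k δ).trans ?_
    rw [mul_assoc, mul_assoc (((k : ℝ) + 2) ^ 3)]
    refine mul_le_mul_of_nonneg_left ?_ (by positivity)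
    have h0 := H₀ f g hf hg
    rw [Fin.sum_univ_three]
    linarith [hi 0, hi 1, hi 2]

/-- The multiplication (algebra) property of the weighted Sobolev spaces of
integer order: for `k₁, k₂ ≥ k`, `k₁ + k₂ ≥ k + 2` and `δ₁ + δ₂ ≥ δ - 3/2`,
`‖uv‖_{k,δ} ≲ ‖u‖_{k₁,δ₁} ‖v‖_{k₂,δ₂}`. -/
theorem stmt9 (k k₁ k₂ : ℕ) (h₁ : k ≤ k₁) (h₂ : k ≤ k₂) (h₁₂ : k + 2 ≤ k₁ + k₂)
    (δ δ₁ δ₂ : ℝ) (hδ : δ - 3 / 2 ≤ δ₁ + δ₂) :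
    ∃ C : ℝ, 0 < C ∧
      ∀ u v : EuclideanSpace ℝ (Fin 3) → ℝ,
        ContDiff ℝ (⊤ : ℕ∞) u → HasCompactSupport u →
        ContDiff ℝ (⊤ : ℕ∞) v → HasCompactSupport v →
        wnorm k δ (fun x => u x * v x) ≤ C * wnorm k₁ δ₁ u * wnorm k₂ δ₂ v := by
  obtain ⟨C, hC, h⟩ := exists_wsq_mul_le k k₁ k₂ h₁ h₂ h₁₂ δ δ₁ δ₂ hδ
  refine ⟨√C, Real.sqrt_pos.2 hC, fun u v hu hu' hv hv' => ?_⟩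
  simp only [wnorm_eq_sqrt_wsq]
  rw [← Real.sqrt_mul hC.le, ← Real.sqrt_mul (mul_nonneg hC.le (wsq_nonneg k₁ δ₁ u))]
  exact Real.sqrt_le_sqrt (h u v ⟨hu, hu'⟩ ⟨hv, hv'⟩)
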